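/- For all ε ∈ (0,1) and all N ≥ ε^{−1}, the smeared rescaled Green's kernel satisfies g_N^ε(z,z') ≤ c ‖ρ‖_∞² (ε ∨ |z−z'|)^{2−d} for all z, z' ∈ ℝ^d, with c depending only on d. -/

import Mathlib

/-!
Pointwise bound for the smeared rescaled Green's kernel `g_N^ε`
(Lemma 6.5 of Deuschel–Rodriguez).
-/

open MeasureTheory

namespace GradientIsomorphism

abbrev Zd (d : ℕ) := Fin d → ℤ
abbrev Rd (d : ℕ) := Fin d → ℝ

def Adjacent {d : ℕ} (x y : Zd d) : Prop := (∑ i, (x i - y i) ^ 2) = 1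
instance {d : ℕ} (x y : Zd d) : Decidable (Adjacent x y) :=
  inferInstanceAs (Decidable ((∑ i, (x i - y i) ^ 2) = 1))

/-- Characterisation of the Green's function of the continuous-time simple random
walk on `ℤ^d`. -/
structure IsLatticeGreen {d : ℕ} (g : Zd d → Zd d → ℝ) : Prop where
  symm : ∀ x y, g x y = g y x
  nonneg : ∀ x y, 0 ≤ g x y
  equation : ∀ x y, (∑' z : Zd d, if Adjacent x z then g z y - g x y else 0)
      = - (if x = y then (1:ℝ) else 0)
  decay : ∀ y, Filter.Tendsto (fun x => g x y) Filter.cofinite (nhds 0)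

noncomputable def floorPt {d : ℕ} (N : ℕ) (z : Rd d) : Zd d := fun i => ⌊(N : ℝ) * z i⌋

/-- Euclidean norm on `ℝ^d`. -/
noncomputable def eNorm {d : ℕ} (z : Rd d) : ℝ := Real.sqrt (∑ i, z i ^ 2)

/-- A mollifier: smooth, nonnegative, supported in `[-1,1]^d`, of total mass one. -/
structure Mollifier (d : ℕ) where
  ρ : Rd d → ℝ
  smooth : ContDiff ℝ (⊤ : ℕ∞) ρ
  nonneg : ∀ z, 0 ≤ ρ z
  supp : ∀ z : Rd d, ρ z ≠ 0 → ∀ i, |z i| ≤ 1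
  mass : ∫ z : Rd d, ρ z = 1

/-- Rescaled mollifier `ρ^ε(⬝) = ε^{-d} ρ(⬝/ε)`. -/
noncomputable def mollEps {d : ℕ} (m : Mollifier d) (ε : ℝ) (y : Rd d) : ℝ :=
  (ε ^ d)⁻¹ * m.ρ (fun i => y i / ε)

/-- Rescaled lattice Green's function `g_N(v,w) = (1/d) N^{d-2} g(⌊Nv⌋,⌊Nw⌋)`. -/
noncomputable def gNfun {d : ℕ} (g : Zd d → Zd d → ℝ) (N : ℕ) (v w : Rd d) : ℝ :=
  (1 / (d : ℝ)) * (N : ℝ) ^ ((d : ℤ) - 2) * g (floorPt N v) (floorPt N w)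

/-- `ρ_N^ε(z,z') = N^d ∫_{⌊Nz'⌋/N + [0,1/N)^d} ρ^ε(z-w) dw`. -/
noncomputable def rhoNeps {d : ℕ} (m : Mollifier d) (ε : ℝ) (N : ℕ) (z z' : Rd d) : ℝ :=
  (N : ℝ) ^ d *
    ∫ w in Set.univ.pi (fun i : Fin d =>
        Set.Ico ((floorPt N z' i : ℝ) / N) ((floorPt N z' i : ℝ) / N + 1 / N)),
      mollEps m ε (z - w)

/-- Smeared rescaled Green's kernel
`g_N^ε(z,z') = ∬ ρ_N^ε(z,v) g_N(v,w) ρ_N^ε(z',w) dv dw`. -/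
noncomputable def gNeps {d : ℕ} (g : Zd d → Zd d → ℝ) (m : Mollifier d) (ε : ℝ) (N : ℕ)
    (z z' : Rd d) : ℝ :=
  ∫ v : Rd d, ∫ w : Rd d, rhoNeps m ε N z v * gNfun g N v w * rhoNeps m ε N z' w

lemma taylor_aux (s : ℝ) : ∃ K C δ : ℝ, 0 < δ ∧ 0 ≤ C ∧ ∀ y : ℝ, |y| < δ →
    (1 + y) ^ (-s) ≤ 1 - s * y + s * (s + 1) / 2 * y ^ 2 + K * y ^ 3 + C * y ^ 4 := by
  have h := (Real.one_add_rpow_hasFPowerSeriesAt_zero (a := -s)).isBigO_sub_partialSum_pow 4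
  obtain ⟨C, hC, hb⟩ := h.exists_pos
  rw [Asymptotics.isBigOWith_iff, Metric.eventually_nhds_iff] at hb
  obtain ⟨δ, hδ, hb⟩ := hb
  refine ⟨Ring.choose (-s) 3, C, δ, hδ, hC.le, fun y hy => ?_⟩
  have := hb (y := y) (by simpa using hy)
  have h2 : Ring.choose (-s) 2 = s * (s+1) / 2 := by
    have := Ring.descPochhammer_eq_factorial_smul_choose (-s) 2
    simp [descPochhammer_succ_right, Polynomial.smeval_mul, Polynomial.smeval_sub] at this
    linarith
  simp [FormalMultilinearSeries.partialSum, Finset.sum_range_succ, binomialSeries] at this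
  rw [h2] at this
  have h3 := (abs_le.1 this).2
  rw [(by decide : Even 4).pow_abs] at h3
  linarith

lemma super_one (s K C δ r x : ℝ) (hC : 0 ≤ C) (hδ : 0 < δ)
    (hT : ∀ y : ℝ, |y| < δ →
      (1 + y) ^ (-s) ≤ 1 - s * y + s * (s + 1) / 2 * y ^ 2 + K * y ^ 3 + C * y ^ 4)
    (hr : 1 ≤ r) (hrδ : 10 / δ ^ 2 < r) (hx : x ^ 2 + 1 ≤ r) :
    (r + 1 + 2 * x) ^ (-s) + (r + 1 - 2 * x) ^ (-s) ≤
      r ^ (-s) * (2 - 2 * s / r + (s * (s + 1) * (1 + 4 * x ^ 2) + (26 * |K| + 82 * C)) / r ^ 2) := by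
  have r0 : 0 < r := by linarith
  have key : ∀ x : ℝ, x ^ 2 + 1 ≤ r → (r + 1 + 2 * x) ^ (-s) ≤ r ^ (-s) *
      (1 - s * ((1 + 2 * x) / r) + s * (s + 1) / 2 * ((1 + 2 * x) / r) ^ 2
        + K * ((1 + 2 * x) / r) ^ 3 + C * ((1 + 2 * x) / r) ^ 4) := by
    intro x hx
    have e : r + 1 + 2 * x = r * (1 + (1 + 2 * x) / r) := by field_simp; ring
    have h1 : 0 ≤ 1 + (1 + 2 * x) / r := by
      have : 0 ≤ r * (1 + (1 + 2 * x) / r) := by rw [← e]; nlinarith [sq_nonneg (x + 1)]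
      exact nonneg_of_mul_nonneg_right this r0
    rw [e, Real.mul_rpow r0.le h1]
    refine mul_le_mul_of_nonneg_left (hT _ ?_) (Real.rpow_nonneg r0.le _)
    apply abs_lt_of_sq_lt_sq _ hδ.le
    rw [div_pow, div_lt_iff₀ (by positivity)]
    rw [div_lt_iff₀ (by positivity)] at hrδ
    have : (1 + 2 * x) ^ 2 ≤ 10 * r := by nlinarith [sq_nonneg (2 * x - 1)]
    nlinarith
  have h1 := key x hx
  have h2 := key (-x) (by simpa using hx)
  rw [show r + 1 + 2 * -x = r + 1 - 2 * x by ring] at h2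
  refine (add_le_add h1 h2).trans ?_
  rw [← mul_add]
  refine mul_le_mul_of_nonneg_left ?_ (Real.rpow_nonneg r0.le _)
  have hK : K * (2 * (1 + 12 * x ^ 2)) / r ^ 3 ≤ 26 * |K| / r ^ 2 := by
    rw [div_le_div_iff₀ (by positivity) (by positivity)]
    have : K * (2 * (1 + 12 * x ^ 2)) ≤ 26 * |K| * r := by
      have h3 : 0 ≤ |K| := abs_nonneg K
      calc K * (2 * (1 + 12 * x ^ 2)) ≤ |K| * (2 * (1 + 12 * x ^ 2)) :=
            mul_le_mul_of_nonneg_right (le_abs_self K) (by positivity)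
        _ ≤ |K| * (26 * r) := mul_le_mul_of_nonneg_left (by nlinarith) h3
        _ = _ := by ring
    calc K * (2 * (1 + 12 * x ^ 2)) * r ^ 2 ≤ 26 * |K| * r * r ^ 2 :=
          mul_le_mul_of_nonneg_right this (by positivity)
      _ = _ := by ring
  have hC' : C * (2 * (1 + 24 * x ^ 2 + 16 * x ^ 4)) / r ^ 4 ≤ 82 * C / r ^ 2 := by
    rw [div_le_div_iff₀ (by positivity) (by positivity)]
    have h5 : 2 * (1 + 24 * x ^ 2 + 16 * x ^ 4) ≤ 82 * r ^ 2 := by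
      have h6 : x ^ 2 ≤ r ^ 2 := by nlinarith
      have h7 : x ^ 4 ≤ r ^ 2 := by nlinarith [sq_nonneg x]
      nlinarith
    calc C * (2 * (1 + 24 * x ^ 2 + 16 * x ^ 4)) * r ^ 2 ≤ C * (82 * r ^ 2) * r ^ 2 := by gcongr
      _ = _ := by ring
  calc _ = 2 - 2 * s / r + s * (s + 1) * (1 + 4 * x ^ 2) / r ^ 2
        + K * (2 * (1 + 12 * x ^ 2)) / r ^ 3 + C * (2 * (1 + 24 * x ^ 2 + 16 * x ^ 4)) / r ^ 4 := by
        field_simp; ring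
    _ ≤ 2 - 2 * s / r + s * (s + 1) * (1 + 4 * x ^ 2) / r ^ 2
        + 26 * |K| / r ^ 2 + 82 * C / r ^ 2 := by linarith
    _ = _ := by ring

/-- Lattice superharmonicity of `(|x|^2 + a)^{-(d-2)/2}` for large `a`. -/
lemma super_exists (d : ℕ) (hd : 3 ≤ d) : ∃ a : ℝ, (d : ℝ) ≤ a ∧ ∀ x : Fin d → ℝ, ∀ r : ℝ,
    r = ∑ i, x i ^ 2 + a →
    ∑ i, ((r + 1 + 2 * x i) ^ (-(((d : ℝ) - 2) / 2)) + (r + 1 - 2 * x i) ^ (-(((d : ℝ) - 2) / 2)))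
      ≤ 2 * d * r ^ (-(((d : ℝ) - 2) / 2)) := by
  have hd' : (3 : ℝ) ≤ d := by exact_mod_cast hd
  obtain ⟨s, hs⟩ : ∃ s : ℝ, s = ((d : ℝ) - 2) / 2 := ⟨_, rfl⟩
  rw [← hs]
  have hs0 : 0 < s := by rw [hs]; linarith
  obtain ⟨K, C, δ, hδ, hC, hT⟩ := taylor_aux s
  have hB : 0 ≤ 26 * |K| + 82 * C := by positivity
  set B := 26 * |K| + 82 * C
  have hq : 0 ≤ d * B / (s * (s + 1)) := by positivity
  have hq2 : 0 ≤ 10 / δ ^ 2 := by positivity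
  refine ⟨d + 1 + 10 / δ ^ 2 + d * B / (s * (s + 1)), by linarith, fun x r hr => ?_⟩
  have hxi : ∀ i, x i ^ 2 ≤ ∑ i, x i ^ 2 := fun i =>
    Finset.single_le_sum (f := fun i => x i ^ 2) (fun i _ => sq_nonneg _) (Finset.mem_univ i)
  have hS : 0 ≤ ∑ i, x i ^ 2 := Finset.sum_nonneg fun i _ => sq_nonneg _
  have r0 : 0 < r := by linarith
  refine (Finset.sum_le_sum fun i _ => super_one s K C δ r (x i) hC hδ hT (by linarith)
    (by linarith) (by linarith [hxi i])).trans ?_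
  rw [← Finset.mul_sum]
  have : ∑ i : Fin d, (2 - 2 * s / r + (s * (s + 1) * (1 + 4 * x i ^ 2) + B) / r ^ 2)
      = d * (2 - 2 * s / r) + (s * (s + 1) * (d + 4 * ∑ i, x i ^ 2) + d * B) / r ^ 2 := by
    rw [Finset.sum_add_distrib, ← Finset.sum_div, Finset.sum_add_distrib, ← Finset.mul_sum,
      Finset.sum_add_distrib, ← Finset.mul_sum]
    simp
    ring
  rw [this, mul_comm (2 * (d : ℝ))]
  refine mul_le_mul_of_nonneg_left ?_ (Real.rpow_nonneg r0.le _)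
  have h1 : s * (s + 1) * (d + 4 * ∑ i, x i ^ 2) + d * B ≤ s * (s + 1) * (4 * r) := by
    have : d * B = s * (s + 1) * (d * B / (s * (s + 1))) := by field_simp
    rw [this, ← mul_add]
    refine mul_le_mul_of_nonneg_left ?_ (by positivity)
    linarith
  have h2 : (s * (s + 1) * (d + 4 * ∑ i, x i ^ 2) + d * B) / r ^ 2 ≤ s * (s + 1) * (4 * r) / r ^ 2 := by
    gcongr
  have h3 : s * (s + 1) * (4 * r) / r ^ 2 = d * (2 * s / r) := by
    have : (d : ℝ) = 2 * s + 2 := by rw [hs]; ring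
    rw [this]; field_simp; ring
  linarith

lemma adjacent_iff {d : ℕ} (x z : Zd d) :
    Adjacent x z ↔ ∃ i, z = x + Pi.single i 1 ∨ z = x - Pi.single i 1 := by
  unfold Adjacent
  constructor
  · intro h
    have h0 : ∀ i, (0:ℤ) ≤ (x i - z i) ^ 2 := fun i => sq_nonneg _
    obtain ⟨i, -, hi⟩ : ∃ i ∈ Finset.univ, (x i - z i) ^ 2 ≠ 0 := by
      apply Finset.exists_ne_zero_of_sum_ne_zero
      rw [h]; norm_num
    have hsplit := Finset.add_sum_erase Finset.univ (fun i => (x i - z i) ^ 2) (Finset.mem_univ i)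
    rw [h] at hsplit
    have hr : 0 ≤ ∑ j ∈ Finset.univ.erase i, (x j - z j) ^ 2 :=
      Finset.sum_nonneg fun j _ => h0 j
    have h1 : (x i - z i) ^ 2 = 1 := by have := h0 i; omega
    have h2 : ∑ j ∈ Finset.univ.erase i, (x j - z j) ^ 2 = 0 := by omega
    rw [Finset.sum_eq_zero_iff_of_nonneg (fun j _ => h0 j)] at h2
    have h3 : ∀ j, j ≠ i → z j = x j := by
      intro j hj
      have := h2 j (by simp [hj])
      have := pow_eq_zero_iff (two_ne_zero) |>.1 this
      omega
    refine ⟨i, ?_⟩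
    rcases (mul_self_eq_one_iff.1 ((sq (x i - z i)).symm.trans h1)) with h | h
    · right
      ext j
      by_cases hj : j = i
      · subst hj; simp; omega
      · simp [hj, h3 j hj]
    · left
      ext j
      by_cases hj : j = i
      · subst hj; simp; omega
      · simp [hj, h3 j hj]
  · rintro ⟨i, h | h⟩
    · subst h
      rw [Finset.sum_eq_single i] <;> simp +contextual
    · subst h
      rw [Finset.sum_eq_single i] <;> simp +contextual

lemma tsum_adjacent {d : ℕ} (x : Zd d) (f : Zd d → ℝ) :
    (∑' z : Zd d, if Adjacent x z then f z else 0) =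
      ∑ i, (f (x + Pi.single i 1) + f (x - Pi.single i 1)) := by
  classical
  let e : Fin d × Bool → Zd d := fun p => if p.2 then x + Pi.single p.1 1 else x - Pi.single p.1 1
  have he : Function.Injective e := by
    rintro ⟨i, b⟩ ⟨j, c⟩ h
    have h1 := congrFun h i
    have h2 := congrFun h j
    by_cases hij : i = j
    · subst hij
      cases b <;> cases c <;> simp [e] at h1 ⊢ <;> omega
    · cases b <;> cases c <;> simp [e, hij] at h1
  rw [tsum_eq_sum (s := Finset.univ.image e)]
  · rw [Finset.sum_image (fun a _ b _ h => he h), Fintype.sum_prod_type]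
    refine Finset.sum_congr rfl fun i _ => ?_
    have h1 : Adjacent x (x + Pi.single i 1) := (adjacent_iff _ _).2 ⟨i, Or.inl rfl⟩
    have h2 : Adjacent x (x - Pi.single i 1) := (adjacent_iff _ _).2 ⟨i, Or.inr rfl⟩
    simp [e, h1, h2]
  · intro z hz
    rw [if_neg]
    intro h
    apply hz
    obtain ⟨i, h | h⟩ := (adjacent_iff _ _).1 h
    · simp only [Finset.mem_image, Finset.mem_univ, true_and]; exact ⟨(i, true), by simp [e, h]⟩
    · simp only [Finset.mem_image, Finset.mem_univ, true_and]; exact ⟨(i, false), by simp [e, h]⟩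

lemma max_principle {d : ℕ} (i0 : Fin d) (h : Zd d → ℝ)
    (hs : ∀ x, ∑ i, ((h (x + Pi.single i 1) - h x) + (h (x - Pi.single i 1) - h x)) ≤ 0)
    (hfin : ∀ t < 0, {x | h x ≤ t}.Finite) (x : Zd d) : 0 ≤ h x := by
  by_contra hx
  push Not at hx
  obtain ⟨p, hp, hpm⟩ := Set.exists_min_image {y | h y ≤ h x} h (hfin _ hx) ⟨x, le_refl (h x)⟩
  have hpm' : ∀ y, h p ≤ h y := by
    intro y
    by_cases hy : h y ≤ h x
    · exact hpm y hy
    · exact le_trans hp (le_of_not_ge hy)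
  have hp0 : h p < 0 := lt_of_le_of_lt hp hx
  obtain ⟨q, hq, hqm⟩ := Set.exists_max_image {y | h y ≤ h p} (fun y => y i0) (hfin _ hp0) ⟨p, le_refl (h p)⟩
  have hq' : h q = h p := le_antisymm hq (hpm' q)
  have h1 : h q < h (q + Pi.single i0 1) := by
    by_contra hc
    push Not at hc
    have := hqm (q + Pi.single i0 1) (hc.trans hq)
    simp at this
  have h2 : 0 < ∑ i, ((h (q + Pi.single i 1) - h q) + (h (q - Pi.single i 1) - h q)) := by
    apply Finset.sum_pos'
    · intro i _
      have := hpm' (q + Pi.single i 1)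
      have := hpm' (q - Pi.single i 1)
      linarith
    · refine ⟨i0, Finset.mem_univ _, ?_⟩
      have := hpm' (q - Pi.single i0 1)
      linarith
  linarith [hs q]

lemma sum_shift {d : ℕ} (u : Fin d → ℝ) (i : Fin d) (c : ℝ) :
    ∑ j, (u j + (Pi.single i c : Fin d → ℝ) j) ^ 2 = ∑ j, u j ^ 2 + c ^ 2 + 2 * c * u i := by
  have : ∀ j, (u j + (Pi.single i c : Fin d → ℝ) j) ^ 2
      = u j ^ 2 + (if j = i then c ^ 2 + 2 * c * u i else 0) := by
    intro j
    by_cases h : j = i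
    · subst h; simp; ring
    · simp [h]
  simp [this, Finset.sum_add_distrib]; ring

lemma green_bound (d : ℕ) (hd : 3 ≤ d) : ∃ a C : ℝ, (d : ℝ) ≤ a ∧ 0 < C ∧
    ∀ g : Zd d → Zd d → ℝ, IsLatticeGreen g → ∀ x y,
      g x y ≤ C * (∑ i, ((x i : ℝ) - y i) ^ 2 + a) ^ (-(((d : ℝ) - 2) / 2)) := by
  have hd' : (3 : ℝ) ≤ d := by exact_mod_cast hd
  obtain ⟨a, had, ha⟩ := super_exists d hd
  obtain ⟨s, hs⟩ : ∃ s : ℝ, s = ((d : ℝ) - 2) / 2 := ⟨_, rfl⟩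
  rw [← hs] at ha ⊢
  have hs0 : 0 < s := by rw [hs]; linarith
  have a0 : 0 < a := by linarith
  set c0 : ℝ := 2 * d * (a ^ (-s) - (a + 1) ^ (-s)) with hc0
  have c0pos : 0 < c0 := by
    have : (a + 1) ^ (-s) < a ^ (-s) := Real.rpow_lt_rpow_of_neg a0 (by linarith) (by linarith)
    apply mul_pos (by linarith) (by linarith)
  refine ⟨a, c0⁻¹, had, by positivity, fun g hg x y => ?_⟩
  let G : Zd d → ℝ := fun x => (∑ i, ((x i : ℝ) - y i) ^ 2 + a) ^ (-s)
  have hG0 : ∀ x, 0 ≤ G x := fun x => Real.rpow_nonneg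
    (add_nonneg (Finset.sum_nonneg fun i _ => sq_nonneg _) a0.le) _
  have hGp : ∀ (x : Zd d) i, G (x + Pi.single i 1) =
      ((∑ i, ((x i : ℝ) - y i) ^ 2 + a) + 1 + 2 * ((x i : ℝ) - y i)) ^ (-s) := by
    intro x i
    have := sum_shift (fun j => (x j : ℝ) - y j) i 1
    have e : ∀ j, (((x + Pi.single i 1 : Zd d) j : ℤ) : ℝ) - y j
        = (x j : ℝ) - y j + (Pi.single i 1 : Fin d → ℝ) j := by
      intro j
      by_cases h : j = i
      · subst h; simp; ring
      · simp [h]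
    simp only [G, e, this]
    congr 1; ring
  have hGm : ∀ (x : Zd d) i, G (x - Pi.single i 1) =
      ((∑ i, ((x i : ℝ) - y i) ^ 2 + a) + 1 - 2 * ((x i : ℝ) - y i)) ^ (-s) := by
    intro x i
    have := sum_shift (fun j => (x j : ℝ) - y j) i (-1)
    have e : ∀ j, (((x - Pi.single i 1 : Zd d) j : ℤ) : ℝ) - y j
        = (x j : ℝ) - y j + (Pi.single i (-1) : Fin d → ℝ) j := by
      intro j
      by_cases h : j = i
      · subst h; simp; ring
      · simp [h]
    simp only [G, e, this]
    congr 1; ring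
  have hLG : ∀ x, ∑ i, ((G (x + Pi.single i 1) - G x) + (G (x - Pi.single i 1) - G x))
      ≤ - (if x = y then c0 else 0) := by
    intro x
    have h1 : ∑ i, ((G (x + Pi.single i 1) - G x) + (G (x - Pi.single i 1) - G x)) =
        ∑ i, (G (x + Pi.single i 1) + G (x - Pi.single i 1)) - 2 * d * G x := by
      rw [show (2 * d * G x) = ∑ i : Fin d, 2 * G x by simp; ring, ← Finset.sum_sub_distrib]
      exact Finset.sum_congr rfl fun i _ => by ring
    rw [h1]
    simp only [hGp, hGm]
    split_ifs with hxy
    · subst hxy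
      simp [G, hc0]
      apply le_of_eq; ring
    · have := ha (fun i => (x i : ℝ) - y i) _ rfl
      simp only [G]
      linarith
  have hh := max_principle (⟨0, by omega⟩ : Fin d) (fun x => c0⁻¹ * G x - g x y) ?_ ?_ x
  · simp only [G] at hh; linarith
  · intro x
    have he := hg.equation x y
    rw [tsum_adjacent x (fun z => g z y - g x y)] at he
    have hl := mul_le_mul_of_nonneg_left (hLG x) (inv_nonneg.2 c0pos.le)
    have e : ∑ i, ((c0⁻¹ * G (x + Pi.single i 1) - g (x + Pi.single i 1) y - (c0⁻¹ * G x - g x y))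
        + (c0⁻¹ * G (x - Pi.single i 1) - g (x - Pi.single i 1) y - (c0⁻¹ * G x - g x y)))
      = c0⁻¹ * ∑ i, ((G (x + Pi.single i 1) - G x) + (G (x - Pi.single i 1) - G x))
        - ∑ i, ((g (x + Pi.single i 1) y - g x y) + (g (x - Pi.single i 1) y - g x y)) := by
      rw [Finset.mul_sum, ← Finset.sum_sub_distrib]
      exact Finset.sum_congr rfl fun i _ => by ring
    rw [e, he]
    have : c0⁻¹ * -(if x = y then c0 else 0) = -(if x = y then 1 else 0) := by
      split_ifs
      · field_simp
      · simp
    linarith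
  · intro t ht
    have h1 := (hg.decay y).eventually (gt_mem_nhds (show (0:ℝ) < -t by linarith))
    rw [Filter.eventually_cofinite] at h1
    refine h1.subset fun z hz => ?_
    simp only [Set.mem_setOf_eq] at hz ⊢
    have : 0 ≤ c0⁻¹ * G z := mul_nonneg (inv_nonneg.2 c0pos.le) (hG0 z)
    linarith

lemma gN_bound (d : ℕ) (hd : 3 ≤ d) : ∃ K : ℝ, 0 < K ∧
    ∀ g : Zd d → Zd d → ℝ, IsLatticeGreen g → ∀ N : ℕ, 0 < N → ∀ v w : Rd d, v ≠ w →
      gNfun g N v w ≤ K * (‖v - w‖ ^ (d - 2))⁻¹ := by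
  have hd' : (3 : ℝ) ≤ d := by exact_mod_cast hd
  obtain ⟨a, C, had, hC, hb⟩ := green_bound d hd
  obtain ⟨s, hs⟩ : ∃ s : ℝ, s = ((d : ℝ) - 2) / 2 := ⟨_, rfl⟩
  rw [← hs] at hb
  have hs0 : 0 < s := by rw [hs]; linarith
  refine ⟨C * 2 ^ s / d, by positivity, fun g hg N hN v w hvw => ?_⟩
  have hN' : (0 : ℝ) < N := by exact_mod_cast hN
  have hD : 0 < ‖v - w‖ := norm_pos_iff.2 (sub_ne_zero.2 hvw)
  set D := ‖v - w‖ with hDdef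
  have hDS : D ^ 2 ≤ ∑ i, (v i - w i) ^ 2 := by
    have h1 : D ≤ Real.sqrt (∑ i, (v i - w i) ^ 2) := by
      rw [hDdef, pi_norm_le_iff_of_nonneg (Real.sqrt_nonneg _)]
      intro i
      rw [Real.norm_eq_abs, Pi.sub_apply]
      apply Real.abs_le_sqrt
      exact Finset.single_le_sum (f := fun i => (v i - w i) ^ 2) (fun i _ => sq_nonneg _)
        (Finset.mem_univ i)
    have h2 := pow_le_pow_left₀ hD.le h1 2
    rwa [Real.sq_sqrt (Finset.sum_nonneg fun i _ => sq_nonneg _)] at h2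
  have hk : (N * D) ^ 2 / 2 ≤ ∑ i, ((floorPt N v i : ℝ) - floorPt N w i) ^ 2 + a := by
    have h1 : ∀ i, ((N : ℝ) * v i - N * w i) ^ 2
        ≤ 2 * ((floorPt N v i : ℝ) - floorPt N w i) ^ 2 + 2 := by
      intro i
      unfold floorPt
      have a1 := Int.floor_le ((N : ℝ) * v i)
      have a2 := Int.lt_floor_add_one ((N : ℝ) * v i)
      have b1 := Int.floor_le ((N : ℝ) * w i)
      have b2 := Int.lt_floor_add_one ((N : ℝ) * w i)
      set p : ℝ := (⌊(N : ℝ) * v i⌋ : ℝ)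
      set q : ℝ := (⌊(N : ℝ) * w i⌋ : ℝ)
      have h3 : ((N : ℝ) * v i - N * w i - (p - q)) ^ 2 ≤ 1 := by
        rw [sq_le_one_iff_abs_le_one, abs_le]; constructor <;> linarith
      nlinarith [sq_nonneg ((N : ℝ) * v i - N * w i - 2 * (p - q))]
    have h2 : ∑ i, ((N : ℝ) * v i - N * w i) ^ 2
        ≤ ∑ i, (2 * ((floorPt N v i : ℝ) - floorPt N w i) ^ 2 + 2) :=
      Finset.sum_le_sum fun i _ => h1 i
    rw [Finset.sum_add_distrib, ← Finset.mul_sum] at h2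
    have h3 : ∑ i, ((N : ℝ) * v i - N * w i) ^ 2 = (N : ℝ) ^ 2 * ∑ i, (v i - w i) ^ 2 := by
      rw [Finset.mul_sum]; exact Finset.sum_congr rfl fun i _ => by ring
    rw [h3] at h2
    simp only [Finset.sum_const, Finset.card_univ, Fintype.card_fin, nsmul_eq_mul] at h2
    have h4 : (N : ℝ) ^ 2 * D ^ 2 ≤ (N : ℝ) ^ 2 * ∑ i, (v i - w i) ^ 2 := by gcongr
    rw [mul_pow]
    linarith
  have hT : 0 < N * D := by positivity
  have hpow : ∀ t : ℝ, 0 < t → (t ^ 2) ^ (-s) = (t ^ (d - 2))⁻¹ := by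
    intro t ht
    rw [← Real.rpow_natCast t 2, ← Real.rpow_mul ht.le, ← Real.rpow_natCast t (d - 2),
      ← Real.rpow_neg ht.le, Nat.cast_sub (by omega), hs]
    congr 1
    push_cast; ring
  have h1 : (∑ i, ((floorPt N v i : ℝ) - floorPt N w i) ^ 2 + a) ^ (-s)
      ≤ 2 ^ s * ((N * D) ^ (d - 2))⁻¹ := by
    refine (Real.rpow_le_rpow_of_nonpos (by positivity) hk (by linarith)).trans ?_
    rw [Real.div_rpow (by positivity) (by norm_num), hpow _ hT, Real.rpow_neg (by norm_num),
      div_inv_eq_mul, mul_comm]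
  have h2 := (hb g hg (floorPt N v) (floorPt N w)).trans (mul_le_mul_of_nonneg_left h1 hC.le)
  unfold gNfun
  have hz : (N : ℝ) ^ ((d : ℤ) - 2) = (N : ℝ) ^ (d - 2) := by
    rw [← zpow_natCast, Nat.cast_sub (by omega)]; rfl
  rw [hz]
  calc _ ≤ 1 / (d : ℝ) * (N : ℝ) ^ (d - 2) * (C * (2 ^ s * ((N * D) ^ (d - 2))⁻¹)) := by gcongr
    _ = _ := by rw [mul_pow]; field_simp

lemma moll_bdd {d : ℕ} (m : Mollifier d) : BddAbove (Set.range m.ρ) := by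
  have hc : HasCompactSupport m.ρ := by
    apply HasCompactSupport.intro (isCompact_closedBall (0 : Rd d) 1)
    intro x hx
    by_contra h
    apply hx
    rw [mem_closedBall_zero_iff, pi_norm_le_iff_of_nonneg zero_le_one]
    exact m.supp x h
  exact m.smooth.continuous.bddAbove_range_of_hasCompactSupport hc

lemma moll_le {d : ℕ} (m : Mollifier d) (x : Rd d) : m.ρ x ≤ ⨆ w, m.ρ w :=
  le_ciSup (moll_bdd m) x

lemma rho_nonneg {d : ℕ} (m : Mollifier d) (ε : ℝ) (hε : 0 < ε) (N : ℕ) (z v : Rd d) :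
    0 ≤ rhoNeps m ε N z v := by
  unfold rhoNeps
  refine mul_nonneg (by positivity) (integral_nonneg fun w => ?_)
  exact mul_nonneg (by positivity) (m.nonneg _)

lemma rho_bound {d : ℕ} (m : Mollifier d) (ε : ℝ) (hε : 0 < ε) (N : ℕ) (hN : ε⁻¹ ≤ N)
    (z v : Rd d) :
    rhoNeps m ε N z v ≤
      (Metric.closedBall z (2 * ε)).indicator (fun _ => (ε ^ d)⁻¹ * ⨆ w, m.ρ w) v := by
  have hN' : (0 : ℝ) < N := lt_of_lt_of_le (by positivity) hN
  have hNe : 1 / (N : ℝ) ≤ ε := by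
    rw [one_div]; exact inv_le_of_inv_le₀ hε hN
  unfold rhoNeps
  by_cases hv : v ∈ Metric.closedBall z (2 * ε)
  · rw [Set.indicator_of_mem hv]
    set S := Set.univ.pi (fun i : Fin d =>
        Set.Ico ((floorPt N v i : ℝ) / N) ((floorPt N v i : ℝ) / N + 1 / N)) with hS
    have hvol : volume S = ENNReal.ofReal ((1 / (N : ℝ)) ^ d) := by
      rw [hS, volume_pi_pi]
      simp only [Real.volume_Ico, add_sub_cancel_left, Finset.prod_const, Finset.card_univ,
        Fintype.card_fin]
      rw [ENNReal.ofReal_pow (by positivity)]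
    have h := norm_setIntegral_le_of_norm_le_const (μ := volume) (s := S)
      (f := fun w => mollEps m ε (z - w)) (C := (ε ^ d)⁻¹ * ⨆ w, m.ρ w)
      (by rw [hvol]; exact ENNReal.ofReal_lt_top) (by
        intro w _
        unfold mollEps
        rw [Real.norm_of_nonneg (mul_nonneg (by positivity) (m.nonneg _))]
        exact mul_le_mul_of_nonneg_left (moll_le m _) (by positivity))
    have h2 := (le_abs_self _).trans h
    rw [Measure.real, hvol, ENNReal.toReal_ofReal (by positivity)] at h2
    calc _ ≤ (N : ℝ) ^ d * (((ε ^ d)⁻¹ * ⨆ w, m.ρ w) * (1 / (N : ℝ)) ^ d) := by gcongr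
      _ = _ := by rw [one_div, inv_pow]; field_simp
  · rw [Set.indicator_of_notMem hv, setIntegral_eq_zero_of_forall_eq_zero, mul_zero]
    intro w hw
    unfold mollEps
    by_contra hne
    have hne' := right_ne_zero_of_mul hne
    apply hv
    rw [Metric.mem_closedBall, dist_pi_le_iff (by positivity)]
    intro i
    have h1 := m.supp _ hne' i
    simp only [Pi.sub_apply] at h1
    rw [abs_div, abs_of_pos hε, div_le_one hε, abs_le] at h1
    have h2 := hw i (Set.mem_univ i)
    have a1 := Int.floor_le ((N : ℝ) * v i)
    have a2 := Int.lt_floor_add_one ((N : ℝ) * v i)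
    have a3 : (floorPt N v i : ℝ) / N ≤ v i := by
      rw [div_le_iff₀ hN', mul_comm]; exact a1
    have a4 : v i ≤ (floorPt N v i : ℝ) / N + 1 / N := by
      rw [← add_div, le_div_iff₀ hN', mul_comm]; exact a2.le
    rw [Real.dist_eq, abs_le]
    constructor <;> linarith [h2.1, h2.2, h1.1, h1.2]

lemma radial (d : ℕ) (hd : 3 ≤ d) : ∃ A : ℝ, 0 < A ∧ ∀ R : ℝ, 0 < R →
    Integrable (fun u : Rd d => (Set.Iic R).indicator (fun y : ℝ => (y ^ (d - 2))⁻¹) ‖u‖) ∧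
    ∫ u : Rd d, (Set.Iic R).indicator (fun y : ℝ => (y ^ (d - 2))⁻¹) ‖u‖ = A * R ^ 2 := by
  haveI : Nonempty (Fin d) := ⟨⟨0, by omega⟩⟩
  haveI : Nontrivial (Rd d) := inferInstance
  have hb : 0 < volume.real (Metric.ball (0 : Rd d) 1) := by
    rw [Measure.real]
    exact ENNReal.toReal_pos (Metric.measure_ball_pos _ _ one_pos).ne' measure_ball_lt_top.ne
  refine ⟨d * volume.real (Metric.ball (0 : Rd d) 1) / 2, by positivity, fun R hR => ?_⟩
  have hdim : Module.finrank ℝ (Rd d) = d := by simp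
  have e : ∀ y ∈ Set.Ioi (0:ℝ), y ^ (d - 1) • (Set.Iic R).indicator (fun y : ℝ => (y ^ (d - 2))⁻¹) y
      = (Set.Iic R).indicator (fun y => y) y := by
    intro y (hy : 0 < y)
    by_cases h : y ≤ R
    · rw [Set.indicator_of_mem (by exact h), Set.indicator_of_mem (by exact h), smul_eq_mul,
        show d - 1 = (d - 2) + 1 by omega, pow_succ]
      field_simp
    · rw [Set.indicator_of_notMem (by exact h), Set.indicator_of_notMem (by exact h), smul_zero]
  constructor
  · rw [integrable_fun_norm_addHaar volume
      (f := (Set.Iic R).indicator (fun y : ℝ => (y ^ (d - 2))⁻¹)), hdim,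
      integrableOn_congr_fun e measurableSet_Ioi, IntegrableOn,
      integrable_indicator_iff measurableSet_Iic, IntegrableOn,
      Measure.restrict_restrict measurableSet_Iic, Set.inter_comm, Set.Ioi_inter_Iic]
    exact (continuous_id.integrableOn_Icc (a := 0) (b := R)).mono_set Set.Ioc_subset_Icc_self
  · rw [integral_fun_norm_addHaar volume
      ((Set.Iic R).indicator (fun y : ℝ => (y ^ (d - 2))⁻¹)), hdim,
      setIntegral_congr_fun measurableSet_Ioi e, setIntegral_indicator measurableSet_Iic,
      Set.Ioi_inter_Iic, ← intervalIntegral.integral_of_le hR.le, integral_id]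
    simp; ring

lemma gNeps_le {d : ℕ} (g : Zd d → Zd d → ℝ) (hg : IsLatticeGreen g) (m : Mollifier d) (ε : ℝ)
    (hε : 0 < ε) (N : ℕ) (hN : ε⁻¹ ≤ N) (z z' : Rd d) (J : ℝ)
    (h : ∀ v ∈ Metric.closedBall z (2 * ε), ∃ ψ : Rd d → ℝ, Integrable ψ ∧ (∀ w, 0 ≤ ψ w) ∧
      ∫ w, ψ w ≤ J ∧ ∀ᵐ w, w ∈ Metric.closedBall z' (2 * ε) → gNfun g N v w ≤ ψ w) :
    gNeps g m ε N z z' ≤ (4 * ε) ^ d * (((ε ^ d)⁻¹ * ⨆ w, m.ρ w) ^ 2 * J) := by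
  have hM : 0 ≤ ⨆ w, m.ρ w := (m.nonneg 0).trans (moll_le m 0)
  set Q := (ε ^ d)⁻¹ * ⨆ w, m.ρ w with hQ
  have hQ0 : 0 ≤ Q := mul_nonneg (by positivity) hM
  have gn : ∀ v w, 0 ≤ gNfun g N v w := fun v w =>
    mul_nonneg (mul_nonneg (by positivity) (zpow_nonneg (by positivity) _)) (hg.nonneg _ _)
  have hnn : ∀ v w, 0 ≤ rhoNeps m ε N z v * gNfun g N v w * rhoNeps m ε N z' w := fun v w =>
    mul_nonneg (mul_nonneg (rho_nonneg m ε hε N z v) (gn v w)) (rho_nonneg m ε hε N z' w)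
  have inner : ∀ v, ∫ w, rhoNeps m ε N z v * gNfun g N v w * rhoNeps m ε N z' w ≤
      (Metric.closedBall z (2 * ε)).indicator (fun _ => Q ^ 2 * J) v := by
    intro v
    have hv1 := rho_bound m ε hε N hN z v
    have hv0 := rho_nonneg m ε hε N z v
    by_cases hv : v ∈ Metric.closedBall z (2 * ε)
    · rw [Set.indicator_of_mem hv] at hv1 ⊢
      obtain ⟨ψ, hi, h0, hJ, hae⟩ := h v hv
      calc _ ≤ ∫ w, Q ^ 2 * ψ w := by
            refine integral_mono_of_nonneg (Filter.Eventually.of_forall (hnn v))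
              (hi.const_mul _) ?_
            filter_upwards [hae] with w hw
            have hw1 := rho_bound m ε hε N hN z' w
            have hw0 := rho_nonneg m ε hε N z' w
            by_cases hwm : w ∈ Metric.closedBall z' (2 * ε)
            · rw [Set.indicator_of_mem hwm] at hw1
              calc _ ≤ Q * ψ w * Q :=
                    mul_le_mul (mul_le_mul hv1 (hw hwm) (gn v w) hQ0) hw1 hw0
                      (mul_nonneg hQ0 (h0 w))
                _ = _ := by ring
            · rw [Set.indicator_of_notMem hwm] at hw1
              rw [le_antisymm hw1 hw0, mul_zero]
              exact mul_nonneg (by positivity) (h0 w)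
        _ = Q ^ 2 * ∫ w, ψ w := integral_const_mul _ _
        _ ≤ _ := by gcongr
    · rw [Set.indicator_of_notMem hv] at hv1 ⊢
      rw [le_antisymm hv1 hv0]
      simp
  unfold gNeps
  calc _ ≤ ∫ v, (Metric.closedBall z (2 * ε)).indicator (fun _ => Q ^ 2 * J) v := by
        refine integral_mono_of_nonneg
          (Filter.Eventually.of_forall fun v => integral_nonneg (hnn v)) ?_
          (Filter.Eventually.of_forall inner)
        rw [integrable_indicator_iff Metric.isClosed_closedBall.measurableSet]
        exact integrableOn_const (measure_closedBall_lt_top.ne)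
    _ = _ := by
        rw [integral_indicator Metric.isClosed_closedBall.measurableSet, setIntegral_const,
          Measure.real, Real.volume_pi_closedBall _ (by positivity),
          ENNReal.toReal_ofReal (by positivity), smul_eq_mul, Fintype.card_fin]
        ring

lemma eNorm_le {d : ℕ} (hd : 3 ≤ d) (u : Rd d) : eNorm u ≤ d * ‖u‖ := by
  have hd' : (3 : ℝ) ≤ d := by exact_mod_cast hd
  unfold eNorm
  apply Real.sqrt_le_iff.2
  refine ⟨by positivity, ?_⟩
  calc ∑ i, u i ^ 2 ≤ ∑ i : Fin d, ‖u‖ ^ 2 := by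
        refine Finset.sum_le_sum fun i _ => ?_
        rw [← sq_abs]
        exact pow_le_pow_left₀ (abs_nonneg _) (norm_le_pi_norm u i) 2
    _ = d * ‖u‖ ^ 2 := by simp
    _ ≤ _ := by rw [mul_pow]; gcongr; nlinarith

theorem smeared_green_kernel_bound (d : ℕ) (hd : 3 ≤ d) :
    ∃ c > (0:ℝ),
      ∀ (g : Zd d → Zd d → ℝ), IsLatticeGreen g →
      ∀ (m : Mollifier d) (ε : ℝ), ε ∈ Set.Ioo (0:ℝ) 1 →
      ∀ N : ℕ, ε⁻¹ ≤ (N : ℝ) →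
      ∀ z z' : Rd d,
        gNeps g m ε N z z' ≤
          c * (⨆ w : Rd d, m.ρ w) ^ 2 * (max ε (eNorm (z - z'))) ^ ((2:ℝ) - d) := by
  have hd' : (3 : ℝ) ≤ d := by exact_mod_cast hd
  haveI : Nonempty (Fin d) := ⟨⟨0, by omega⟩⟩
  obtain ⟨K, hK, hgN⟩ := gN_bound d hd
  obtain ⟨A, hA, hrad⟩ := radial d hd
  set c1 : ℝ := 4 ^ d * 4 ^ d * K + 4 ^ d * 144 * K * A with hc1
  have c1pos : 0 < c1 := by positivity
  refine ⟨c1 * (8 * d) ^ (d - 2), by positivity, fun g hg m ε hε N hN z z' => ?_⟩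
  have hε0 : 0 < ε := hε.1
  have hN' : 0 < N := by
    have : (0 : ℝ) < N := lt_of_lt_of_le (by positivity) hN
    exact_mod_cast this
  have hM : 0 ≤ ⨆ w, m.ρ w := (m.nonneg 0).trans (moll_le m 0)
  set M := ⨆ w, m.ρ w with hMdef
  set X := max ε (eNorm (z - z')) with hX
  have hX0 : 0 < X := lt_of_lt_of_le hε0 (le_max_left _ _)
  have hXr : X ^ ((2:ℝ) - d) = (X ^ (d - 2))⁻¹ := by
    rw [← Real.rpow_natCast X (d - 2), ← Real.rpow_neg hX0.le, Nat.cast_sub (by omega)]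
    congr 1; push_cast; ring
  rw [hXr]
  have hsplit : ε ^ d = ε ^ (d - 2) * ε ^ 2 := by rw [← pow_add]; congr 1; omega
  -- reduction to a length scale `l`
  suffices hl : ∃ l : ℝ, 0 < l ∧ X ≤ 8 * d * l ∧ gNeps g m ε N z z' ≤ c1 * M ^ 2 * (l ^ (d - 2))⁻¹ by
    obtain ⟨l, hl0, hXl, hb⟩ := hl
    refine hb.trans ?_
    have h1 : (l ^ (d - 2))⁻¹ ≤ (8 * d) ^ (d - 2) * (X ^ (d - 2))⁻¹ := by
      rw [← div_eq_mul_inv, inv_eq_one_div, div_le_div_iff₀ (by positivity) (by positivity), one_mul,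
        ← mul_pow]
      gcongr
    calc _ ≤ c1 * M ^ 2 * ((8 * d) ^ (d - 2) * (X ^ (d - 2))⁻¹) := by gcongr
      _ = _ := by ring
  have hE := eNorm_le hd (z - z')
  by_cases hcase : 8 * ε ≤ ‖z - z'‖
  · set D := ‖z - z'‖ with hD
    have hD0 : 0 < D := by linarith
    refine ⟨D / 2, by positivity, max_le (by nlinarith) (by nlinarith), ?_⟩
    refine (gNeps_le g hg m ε hε0 N hN z z' ((4 * ε) ^ d * (K * ((D / 2) ^ (d - 2))⁻¹)) ?_).trans ?_
    · intro v hv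
      refine ⟨(Metric.closedBall z' (2 * ε)).indicator (fun _ => K * ((D / 2) ^ (d - 2))⁻¹),
        ?_, ?_, ?_, ?_⟩
      · rw [integrable_indicator_iff Metric.isClosed_closedBall.measurableSet]
        exact integrableOn_const (measure_closedBall_lt_top.ne)
      · exact fun w => Set.indicator_nonneg (fun _ _ => by positivity) w
      · rw [integral_indicator Metric.isClosed_closedBall.measurableSet, setIntegral_const,
          Measure.real, Real.volume_pi_closedBall _ (by positivity),
          ENNReal.toReal_ofReal (by positivity), smul_eq_mul, Fintype.card_fin]
        apply le_of_eq; ring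
      · refine Filter.Eventually.of_forall fun w hw => ?_
        rw [Set.indicator_of_mem hw]
        rw [Metric.mem_closedBall, dist_eq_norm] at hv hw
        have h1 : D / 2 ≤ ‖v - w‖ := by
          have : z - z' = (v - w) - (v - z) + (w - z') := by abel
          have h2 : D ≤ ‖v - w‖ + ‖v - z‖ + ‖w - z'‖ := by
            rw [hD, this]
            exact (norm_add_le _ _).trans (by gcongr; exact norm_sub_le _ _)
          linarith
        have hne : v ≠ w := by
          intro h; rw [h, sub_self, norm_zero] at h1; linarith
        refine (hgN g hg N hN' v w hne).trans ?_
        gcongr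
    · have : (4 * ε) ^ d * (((ε ^ d)⁻¹ * M) ^ 2 * ((4 * ε) ^ d * (K * ((D / 2) ^ (d - 2))⁻¹)))
          = 4 ^ d * 4 ^ d * K * M ^ 2 * ((D / 2) ^ (d - 2))⁻¹ := by
        rw [mul_pow 4 ε]; generalize ((D / 2) ^ (d - 2))⁻¹ = t; field_simp
      rw [this]
      gcongr
      rw [hc1]
      have : 0 ≤ 4 ^ d * 144 * K * A := by positivity
      linarith
  · push Not at hcase
    refine ⟨ε, hε0, max_le (by nlinarith) (by nlinarith [norm_nonneg (z - z')]), ?_⟩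
    obtain ⟨hi, hval⟩ := hrad (12 * ε) (by positivity)
    set φ : Rd d → ℝ := fun u => (Set.Iic (12 * ε)).indicator (fun y : ℝ => (y ^ (d - 2))⁻¹) ‖u‖
      with hφ
    refine (gNeps_le g hg m ε hε0 N hN z z' (K * (A * (12 * ε) ^ 2)) ?_).trans ?_
    · intro v hv
      refine ⟨fun w => K * φ (v - w), (hi.comp_sub_left v).const_mul K, ?_, ?_, ?_⟩
      · intro w
        refine mul_nonneg hK.le ?_
        exact Set.indicator_apply_nonneg fun _ => by positivity
      · rw [integral_const_mul, integral_sub_left_eq_self φ volume v, hval]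
      · have hae : ∀ᵐ w : Rd d, w ≠ v := by
          rw [ae_iff]; simp
        filter_upwards [hae] with w hwv hw
        rw [Metric.mem_closedBall, dist_eq_norm] at hv hw
        have h1 : ‖v - w‖ ≤ 12 * ε := by
          have : v - w = (v - z) + (z - z') - (w - z') := by abel
          have h2 : ‖v - w‖ ≤ ‖v - z‖ + ‖z - z'‖ + ‖w - z'‖ := by
            rw [this]
            exact (norm_sub_le _ _).trans (by gcongr; exact norm_add_le _ _)
          linarith
        have h3 : φ (v - w) = (‖v - w‖ ^ (d - 2))⁻¹ := by
          simp only [hφ]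
          rw [Set.indicator_of_mem (by exact h1)]
        rw [h3]
        exact hgN g hg N hN' v w hwv.symm
    · have : (4 * ε) ^ d * (((ε ^ d)⁻¹ * M) ^ 2 * (K * (A * (12 * ε) ^ 2)))
          = 4 ^ d * 144 * K * A * M ^ 2 * (ε ^ (d - 2))⁻¹ := by
        rw [mul_pow 4 ε, hsplit]; field_simp; ring
      rw [this]
      gcongr
      rw [hc1]
      have : 0 ≤ 4 ^ d * 4 ^ d * K := by positivity
      linarith

end GradientIsomorphism
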